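/- arXiv:2005.08574 — 7 statements merged into one kernel-verified Lean document; each statement's English description precedes it below -/
import Mathlib

section
/- Let Δ be a region of the Shi arrangement S_n (the case r = 1) and x ∈ Δ; define the n×n matrix A_x by a_{ij}(x) = x_i − x_j − 1 if i < j, a_{ij}(x) = 0 if i = j, and a_{ij}(x) = x_i − x_j if i > j. For each j ∈ {1,…,n}: if column j of A_x has no positive entry, set p_j = 0; otherwise column j of A_x has a unique minimal positive entry, located at row p_j. Let T_x be the graph on the vertex set {0, 1, …, n} in which each vertex j ∈ {1,…,n} is joined to p_j. Then T_x is a tree on {0,1,…,n}, T_x is independent of the choice of x ∈ Δ, and the map Δ ↦ T_x is a bijection from the set of regions of S_n onto the set of all trees on the vertex set {0,1,…,n}. -/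
/-- The complement of the Shi arrangement `S_n` in `ℝⁿ` (hyperplanes `xᵢ - xⱼ = 0, 1` for
`i < j`). -/
def shiComplOne (n : ℕ) : Set (Fin n → ℝ) :=
  {x | ∀ i j : Fin n, i < j → x i - x j ≠ 0 ∧ x i - x j ≠ 1}

/-- The matrix entry `a_{ij}(x)`: `xᵢ - xⱼ - 1` if `i < j`, `0` if `i = j`, and `xᵢ - xⱼ`
if `i > j`. -/
noncomputable def aEntry {n : ℕ} (x : Fin n → ℝ) (i j : Fin n) : ℝ :=
  if i < j then x i - x j - 1 else if j < i then x i - x j else 0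

/-- Vertex `p ∈ {0,1,…,n}` is the father of `j ∈ {1,…,n}` determined by `x`: either
column `j` of `A_x` has no positive entry and `p = 0`, or `p` is (the successor of) the
row index of the unique minimal positive entry of column `j`. -/
def IsFatherOne {n : ℕ} (x : Fin n → ℝ) (j : Fin n) (p : Fin (n + 1)) : Prop :=
  (p = 0 ∧ ∀ i : Fin n, aEntry x i j ≤ 0) ∨
    ∃ i : Fin n, p = i.succ ∧ 0 < aEntry x i j ∧
      ∀ i' : Fin n, 0 < aEntry x i' j → aEntry x i j ≤ aEntry x i' j


lemma shi_exists_below {n : ℕ} (T : Finset (Fin n)) (f : Fin n → ℝ) (c : ℝ) :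
    ∃ c' < c, c - 1 < c' ∧ ∀ i ∈ T, f i < c → f i < c' := by
  classical
  induction T using Finset.induction_on with
  | empty => exact ⟨c - 1/2, by linarith, by linarith, by simp⟩
  | insert a T ha ih =>
    obtain ⟨c', h1, h2, h3⟩ := ih
    by_cases h : f a < c
    · refine ⟨max c' ((f a + c)/2), by simp; constructor <;> linarith, lt_max_of_lt_left h2, ?_⟩
      intro i hi hic
      rcases Finset.mem_insert.1 hi with rfl | hi
      · exact lt_max_of_lt_right (by linarith)
      · exact lt_max_of_lt_left (h3 i hi hic)
    · refine ⟨c', h1, h2, ?_⟩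
      intro i hi hic
      rcases Finset.mem_insert.1 hi with rfl | hi
      · exact absurd hic h
      · exact h3 i hi hic

/-- entry of column `v` with variable level `z`. -/
noncomputable def shiE {n : ℕ} (x : Fin n → ℝ) (z : ℝ) (i v : Fin n) : ℝ :=
  if i < v then x i - z - 1 else if v < i then x i - z else 0

def shiF {n : ℕ} (p : Fin n → Fin (n+1)) (S : Finset (Fin n)) (x : Fin n → ℝ) (z : ℝ)
    (v : Fin n) : Prop :=
  (p v = 0 ∧ ∀ i ∈ S, shiE x z i v ≤ 0) ∨
    ∃ m ∈ S, p v = m.succ ∧ 0 < shiE x z m v ∧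
      ∀ i ∈ S, 0 < shiE x z i v → shiE x z m v ≤ shiE x z i v

def shiW {n : ℕ} (p : Fin n → Fin (n+1)) (S : Finset (Fin n)) (x : Fin n → ℝ) (z : ℝ)
    (v : Fin n) : Prop :=
  p v = 0 ∨ ∃ m ∈ S, p v = m.succ ∧ 0 < shiE x z m v

structure ShiState {n : ℕ} (p : Fin n → Fin (n+1)) (S : Finset (Fin n)) (x : Fin n → ℝ)
    (c : ℝ) : Prop where
  lt : ∀ i ∈ S, c < x i
  ne : ∀ i ∈ S, x i - 1 ≠ c
  gen : ∀ i ∈ S, ∀ j ∈ S, i ≠ j → x i ≠ x j ∧ x i - x j ≠ 1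
  fath : ∀ v ∈ S, shiF p S x (x v) v
  wait : ∀ v, v ∉ S → shiW p S x c v → shiF p S x c v

lemma shi_stepB {n : ℕ} (p : Fin n → Fin (n+1)) (d : Fin n → ℕ)
    (hd : ∀ v m, p v = m.succ → d m < d v) (S : Finset (Fin n)) (x : Fin n → ℝ) (c : ℝ)
    (h : ShiState p S x c) (hS : ∃ v, v ∉ S) :
    ∃ c', ShiState p S x c' ∧ ∃ v, v ∉ S ∧ shiW p S x c' v := by
  classical
  by_cases hW : ∃ v, v ∉ S ∧ shiW p S x c v
  · exact ⟨c, h, hW⟩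
  push Not at hW
  -- the set of possible fathers
  let M := S.filter (fun m => ∃ v, v ∉ S ∧ p v = m.succ)
  have hM : M.Nonempty := by
    have : (Finset.univ.filter (fun v => v ∉ S)).Nonempty := by
      obtain ⟨v, hv⟩ := hS; exact ⟨v, by simpa using hv⟩
    obtain ⟨v, hv, hmin⟩ := Finset.exists_min_image _ d this
    simp only [Finset.mem_filter, Finset.mem_univ, true_and] at hv hmin
    have hp : p v ≠ 0 := fun h0 => hW v hv (Or.inl h0)
    obtain ⟨m, hm⟩ := Fin.exists_succ_eq.2 hp
    refine ⟨m, Finset.mem_filter.2 ⟨?_, v, hv, hm.symm⟩⟩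
    by_contra hmS
    have := hmin m hmS
    have := hd v m hm.symm
    omega
  obtain ⟨m, hmM, hmax⟩ := Finset.exists_max_image M x hM
  obtain ⟨hmS, v0, hv0, hpv0⟩ := Finset.mem_filter.1 hmM
  have key : ∀ k ∈ S, ∀ v, v ∉ S → p v = k.succ → k < v ∧ x k - 1 < c := by
    intro k hk v hv hpv
    have hne : k ≠ v := fun e => hv (e ▸ hk)
    have h1 : ¬ 0 < shiE x c k v := fun h0 => hW v hv (Or.inr ⟨k, hk, hpv, h0⟩)
    have h2 := h.lt k hk
    have h3 := h.ne k hk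
    unfold shiE at h1
    rcases lt_or_gt_of_ne hne with hl | hl
    · refine ⟨hl, lt_of_le_of_ne ?_ h3⟩
      simp only [hl, if_true] at h1
      linarith
    · exfalso
      rw [if_neg (not_lt.2 hl.le), if_pos hl] at h1
      linarith
  obtain ⟨hm1, hm2⟩ := key m hmS v0 hv0 hpv0
  obtain ⟨c', hc1, hc2, hc3⟩ := shi_exists_below S (fun i => x i - 1) (x m - 1)
  refine ⟨c', ⟨?_, ?_, h.gen, h.fath, ?_⟩, v0, hv0, Or.inr ⟨m, hmS, hpv0, ?_⟩⟩
  · intro i hi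
    have := h.lt i hi
    linarith
  · intro i hi e
    have := hc3 i hi (by linarith)
    linarith
  · intro v hv hw
    rcases hw with h0 | ⟨k, hk, hpk, hpos⟩
    · exact absurd (Or.inl h0) (hW v hv)
    obtain ⟨hk1, hk2⟩ := key k hk v hv hpk
    have hxk : x k ≤ x m := hmax k (Finset.mem_filter.2 ⟨hk, v, hv, hpk⟩)
    have hge : ∀ i ∈ S, c' < x i - 1 → x m ≤ x i := by
      intro i hi h1
      by_contra h2
      have := hc3 i hi (by linarith)
      linarith
    refine Or.inr ⟨k, hk, hpk, hpos, ?_⟩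
    intro i hi hipos
    have := h.lt i hi
    unfold shiE at hpos hipos ⊢
    rw [if_pos hk1] at hpos ⊢
    split_ifs at hipos ⊢ with h1 h2
    · have := hge i hi (by linarith)
      linarith
    · linarith
    · linarith
  · unfold shiE
    rw [if_pos hm1]; linarith

lemma shi_stepA {n : ℕ} (p : Fin n → Fin (n+1)) (d : Fin n → ℕ)
    (hd : ∀ v m, p v = m.succ → d m < d v) (S : Finset (Fin n)) (x : Fin n → ℝ) (c : ℝ)
    (h : ShiState p S x c) (hS : ∃ v, v ∉ S ∧ shiW p S x c v) :
    ∃ v, v ∉ S ∧ ∃ x' c', ShiState p (insert v S) x' c' := by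
  classical
  have : (Finset.univ.filter (fun v => v ∉ S ∧ shiW p S x c v)).Nonempty := by
    obtain ⟨v, hv⟩ := hS; exact ⟨v, by simpa using hv⟩
  obtain ⟨v, hv, hmin⟩ := Finset.exists_min_image _ id this
  simp only [Finset.mem_filter, Finset.mem_univ, true_and, id] at hv hmin
  obtain ⟨hvS, hvW⟩ := hv
  obtain ⟨c', hc1, hc2, hc3⟩ := shi_exists_below S (fun i => x i - 1) c
  have hxv : Function.update x v c v = c := by simp
  have hxo : ∀ i, i ≠ v → Function.update x v c i = x i := fun i hi => by simp [hi]
  have hxS : ∀ i ∈ S, Function.update x v c i = x i := fun i hi =>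
    hxo i (fun e => hvS (e ▸ hi))
  generalize Function.update x v c = x' at hxv hxo hxS
  have hES : ∀ z, ∀ i ∈ S, ∀ w, shiE x' z i w = shiE x z i w := by
    intro z i hi w; unfold shiE; rw [hxS i hi]
  refine ⟨v, hvS, x', c', ⟨?_, ?_, ?_, ?_, ?_⟩⟩
  · intro i hi
    rcases Finset.mem_insert.1 hi with rfl | hi
    · linarith
    · rw [hxS i hi]; linarith [h.lt i hi]
  · intro i hi
    rcases Finset.mem_insert.1 hi with rfl | hi
    · rw [hxv]; intro e; linarith
    · rw [hxS i hi]; intro e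
      have := hc3 i hi (by linarith)
      linarith
  · intro i hi j hj hij
    rcases Finset.mem_insert.1 hi with rfl | hi' <;> rcases Finset.mem_insert.1 hj with rfl | hj'
    · exact absurd rfl hij
    · rw [hxv, hxS j hj']
      have := h.lt j hj'
      constructor <;> intro e <;> linarith
    · rw [hxv, hxS i hi']
      have := h.lt i hi'
      have h2 := h.ne i hi'
      constructor <;> intro e
      · linarith
      · exact h2 (by linarith)
    · rw [hxS i hi', hxS j hj']; exact h.gen i hi' j hj' hij
  · intro w hw
    have hF : shiF p S x (x' w) w ∧ shiE x' (x' w) v w ≤ 0 := by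
      rcases Finset.mem_insert.1 hw with rfl | hw
      · rw [hxv]; exact ⟨h.wait _ hvS hvW, by simp [shiE]⟩
      · rw [hxS w hw]
        refine ⟨h.fath w hw, ?_⟩
        have := h.lt w hw
        unfold shiE
        rw [hxv]
        split_ifs <;> linarith
    obtain ⟨hF, hvv⟩ := hF
    rcases hF with ⟨h0, h1⟩ | ⟨m, hm, hpm, hpos, hle⟩
    · refine Or.inl ⟨h0, ?_⟩
      intro i hi
      rcases Finset.mem_insert.1 hi with rfl | hi
      · exact hvv
      · rw [hES _ i hi]; exact h1 i hi
    · refine Or.inr ⟨m, Finset.mem_insert_of_mem hm, hpm, by rwa [hES _ m hm], ?_⟩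
      intro i hi hip
      rcases Finset.mem_insert.1 hi with rfl | hi
      · linarith
      · rw [hES _ i hi] at hip ⊢; rw [hES _ m hm]; exact hle i hi hip
  · intro w hw hwW
    have hwv : w ≠ v := fun e => hw (e ▸ Finset.mem_insert_self _ _)
    have hwS : w ∉ S := fun e => hw (Finset.mem_insert_of_mem e)
    have hpos_iff : ∀ i ∈ S, (0 < shiE x' c' i w ↔ 0 < shiE x c i w) ∧
        (0 < shiE x c i w → shiE x' c' i w = shiE x c i w + (c - c')) := by
      intro i hi
      rw [hES _ i hi]
      have h1 := h.lt i hi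
      have h2 := h.ne i hi
      have h3 := hc3 i hi
      unfold shiE
      split_ifs
      · refine ⟨⟨fun h4 => ?_, fun h4 => by linarith⟩, fun _ => by ring⟩
        by_contra h5
        have := h3 (lt_of_le_of_ne (by linarith) h2)
        linarith
      · exact ⟨⟨fun h4 => by linarith, fun h4 => by linarith⟩, fun _ => by ring⟩
      · exact ⟨Iff.rfl, fun h => absurd h (lt_irrefl _)⟩
    have hold : shiW p S x c w → shiF p (insert v S) x' c' w := by
      intro hW
      have hvw : v < w := lt_of_le_of_ne (hmin w ⟨hwS, hW⟩) hwv.symm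
      have hvv : shiE x' c' v w ≤ 0 := by
        unfold shiE; rw [if_pos hvw, hxv]; linarith
      rcases h.wait w hwS hW with ⟨h0, h1⟩ | ⟨m, hm, hpm, hpos, hle⟩
      · refine Or.inl ⟨h0, ?_⟩
        intro i hi
        rcases Finset.mem_insert.1 hi with rfl | hi
        · exact hvv
        · have := h1 i hi
          by_contra h2
          have := (hpos_iff i hi).1.1 (by linarith)
          linarith
      · refine Or.inr ⟨m, Finset.mem_insert_of_mem hm, hpm, (hpos_iff m hm).1.2 hpos, ?_⟩
        intro i hi hip
        rcases Finset.mem_insert.1 hi with rfl | hi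
        · linarith
        · have h1 := (hpos_iff i hi).1.1 hip
          rw [(hpos_iff i hi).2 h1, (hpos_iff m hm).2 hpos]
          linarith [hle i hi h1]
    rcases hwW with h0 | ⟨m, hm, hpm, hpos⟩
    · exact hold (Or.inl h0)
    rcases Finset.mem_insert.1 hm with rfl | hmS
    · refine Or.inr ⟨m, Finset.mem_insert_self _ _, hpm, hpos, ?_⟩
      intro i hi hip
      rcases Finset.mem_insert.1 hi with rfl | hi
      · exact le_rfl
      have h1 := h.lt i hi
      rw [(hpos_iff i hi).2 ((hpos_iff i hi).1.1 hip)]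
      have h2 := (hpos_iff i hi).1.1 hip
      have h3 : shiE x' c' m w ≤ c - c' := by
        unfold shiE; rw [hxv]; split_ifs <;> linarith
      linarith
    · exact hold (Or.inr ⟨m, hmS, hpm, (hpos_iff m hmS).1.1 hpos⟩)

lemma shi_exists {n : ℕ} (p : Fin n → Fin (n+1)) (d : Fin n → ℕ)
    (hd : ∀ v m, p v = m.succ → d m < d v) :
    ∃ x ∈ shiComplOne n, ∀ v, IsFatherOne x v (p v) := by
  classical
  have main : ∀ k ≤ n, ∃ S : Finset (Fin n), S.card = k ∧ ∃ x c, ShiState p S x c := by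
    intro k
    induction k with
    | zero =>
      intro _
      refine ⟨∅, rfl, 0, 0, ?_⟩
      refine ⟨by simp, by simp, by simp, by simp, ?_⟩
      intro v _ hv
      rcases hv with h | ⟨m, hm, _⟩
      · exact Or.inl ⟨h, by simp⟩
      · simp at hm
    | succ k ih =>
      intro hk
      obtain ⟨S, hS, x, c, h⟩ := ih (by omega)
      have hex : ∃ v, v ∉ S := by
        by_contra hcon
        push Not at hcon
        have : S = Finset.univ := Finset.eq_univ_iff_forall.2 hcon
        rw [this, Finset.card_univ, Fintype.card_fin] at hS
        omega
      obtain ⟨c', h', hex'⟩ := shi_stepB p d hd S x c h hex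
      obtain ⟨v, hv, x', c'', h''⟩ := shi_stepA p d hd S x c' h' hex'
      exact ⟨insert v S, by rw [Finset.card_insert_of_notMem hv, hS], x', c'', h''⟩
  obtain ⟨S, hS, x, c, h⟩ := main n le_rfl
  have hu : S = Finset.univ := by
    rw [← Finset.card_eq_iff_eq_univ, hS, Fintype.card_fin]
  subst hu
  refine ⟨x, ?_, ?_⟩
  · intro i j hij
    have := h.gen i (Finset.mem_univ _) j (Finset.mem_univ _) hij.ne
    exact ⟨sub_ne_zero.2 this.1, this.2⟩
  · intro v
    have hE : ∀ i, shiE x (x v) i v = aEntry x i v := fun i => rfl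
    rcases h.fath v (Finset.mem_univ _) with ⟨h0, h1⟩ | ⟨m, _, hpm, hpos, hle⟩
    · exact Or.inl ⟨h0, fun i => h1 i (Finset.mem_univ _)⟩
    · exact Or.inr ⟨m, hpm, hpos, fun i hi => hle i (Finset.mem_univ _) hi⟩

/-- graph of a father function -/
def shiG {n : ℕ} (p : Fin n → Fin (n+1)) : SimpleGraph (Fin (n+1)) where
  Adj u v := u ≠ v ∧ ∃ j : Fin n, (u = j.succ ∧ v = p j) ∨ (v = j.succ ∧ u = p j)
  symm := ⟨fun u v ⟨h, j, hj⟩ => ⟨h.symm, j, hj.symm⟩⟩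
  loopless := ⟨fun u h => h.1 rfl⟩

def ShiDecr {n : ℕ} (p : Fin n → Fin (n+1)) : Prop :=
  ∃ d : Fin n → ℕ, ∀ v m, p v = m.succ → d m < d v

lemma ShiDecr.ne {n : ℕ} {p : Fin n → Fin (n+1)} (h : ShiDecr p) (j : Fin n) :
    j.succ ≠ p j := by
  obtain ⟨d, hd⟩ := h
  intro e
  exact lt_irrefl _ (hd j j e.symm)

lemma shiG_adj {n : ℕ} {p : Fin n → Fin (n+1)} (h : ShiDecr p) (u v : Fin (n+1)) :
    (shiG p).Adj u v ↔ ∃ j : Fin n, (u = j.succ ∧ v = p j) ∨ (v = j.succ ∧ u = p j) := by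
  refine ⟨fun h => h.2, fun ⟨j, hj⟩ => ⟨?_, j, hj⟩⟩
  rcases hj with ⟨rfl, rfl⟩ | ⟨rfl, rfl⟩
  · exact h.ne j
  · exact (h.ne j).symm

lemma shiG_connected {n : ℕ} {p : Fin n → Fin (n+1)} (h : ShiDecr p) :
    (shiG p).Connected := by
  have hp := h
  obtain ⟨d, hd⟩ := h
  have key : ∀ N, ∀ j : Fin n, d j < N → (shiG p).Reachable j.succ 0 := by
    intro N
    induction N with
    | zero => intro j hj; omega
    | succ N ih =>
      intro j hj
      have hadj : (shiG p).Adj j.succ (p j) := (shiG_adj hp _ _).2 ⟨j, Or.inl ⟨rfl, rfl⟩⟩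
      refine hadj.reachable.trans ?_
      by_cases h0 : p j = 0
      · rw [h0]
      · obtain ⟨m, hm⟩ := Fin.exists_succ_eq.2 h0
        have := hd j m hm.symm
        rw [← hm]
        exact ih m (by omega)
  have key2 : ∀ u, (shiG p).Reachable u 0 := by
    intro u
    by_cases h0 : u = 0
    · rw [h0]
    · obtain ⟨m, hm⟩ := Fin.exists_succ_eq.2 h0
      rw [← hm]; exact key _ m (Nat.lt_succ_self _)
  exact { preconnected := fun u v => (key2 u).trans (key2 v).symm, nonempty := ⟨0⟩ }

lemma shiG_tree {n : ℕ} {p : Fin n → Fin (n+1)} (h : ShiDecr p) :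
    (shiG p).IsTree := by
  classical
  have hc := shiG_connected h
  rw [SimpleGraph.isTree_iff_connected_and_card]
  refine ⟨hc, ?_⟩
  have h1 := hc.card_vert_le_card_edgeSet_add_one
  have h2 : Nat.card (shiG p).edgeSet ≤ n := by
    have hs : (shiG p).edgeSet ⊆ Set.range (fun j : Fin n => s(j.succ, p j)) := by
      intro e
      induction e with
      | _ u v =>
        intro he
        rw [SimpleGraph.mem_edgeSet] at he
        obtain ⟨_, j, ⟨rfl, rfl⟩ | ⟨rfl, rfl⟩⟩ := he
        · exact ⟨j, rfl⟩
        · exact ⟨j, Sym2.eq_swap⟩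
    calc Nat.card (shiG p).edgeSet ≤ Nat.card (Set.range (fun j : Fin n => s(j.succ, p j))) :=
          Nat.card_mono (Set.toFinite _) hs
      _ ≤ Nat.card (Fin n) := Finite.card_range_le _
      _ = n := by simp
  simp only [Nat.card_eq_fintype_card, Fintype.card_fin] at h1 h2 ⊢
  omega

lemma shiG_inj {n : ℕ} {p q : Fin n → Fin (n+1)} (hp : ShiDecr p) (hq : ShiDecr q)
    (h : shiG p = shiG q) : p = q := by
  obtain ⟨d, hd⟩ := id hp
  have key : ∀ N, ∀ j : Fin n, d j < N → p j = q j := by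
    intro N
    induction N with
    | zero => intro j hj; omega
    | succ N ih =>
      intro j hj
      have hadj : (shiG p).Adj j.succ (p j) := (shiG_adj hp _ _).2 ⟨j, Or.inl ⟨rfl, rfl⟩⟩
      rw [h, shiG_adj hq] at hadj
      obtain ⟨k, ⟨h1, h2⟩ | ⟨h1, h2⟩⟩ := hadj
      · have := Fin.succ_injective _ h1
        subst this; exact h2
      · have h3 := hd j k h1
        have h4 := ih k (by omega)
        have h5 := hd k j (h4.trans h2.symm)
        omega
  exact funext fun j => key _ j (Nat.lt_succ_self _)

lemma shiG_surj {n : ℕ} (G : SimpleGraph (Fin (n+1))) (hG : G.IsTree) :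
    ∃ p : Fin n → Fin (n+1), ShiDecr p ∧ shiG p = G := by
  have hex : ∀ j : Fin n, ∃ u, G.Adj j.succ u ∧ G.dist u 0 < G.dist j.succ 0 := by
    intro j
    obtain ⟨w, hw⟩ := hG.connected.exists_walk_length_eq_dist j.succ 0
    cases w with
    | cons hadj w' =>
      refine ⟨_, hadj, ?_⟩
      have := SimpleGraph.dist_le w'
      rw [SimpleGraph.Walk.length_cons] at hw
      omega
  choose p hp1 hp2 using hex
  have hdec : ShiDecr p := ⟨fun j => G.dist j.succ 0, fun v m hm => by
    have := hp2 v
    rwa [hm] at this⟩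
  refine ⟨p, hdec, ?_⟩
  have hle : shiG p ≤ G := by
    intro u v huv
    obtain ⟨_, j, ⟨rfl, rfl⟩ | ⟨rfl, rfl⟩⟩ := huv
    · exact hp1 j
    · exact (hp1 j).symm
  exact le_antisymm hle
    ((SimpleGraph.isTree_iff_minimal_connected.1 hG).2 (shiG_connected hdec) hle)

lemma shi_ne {n : ℕ} {x : Fin n → ℝ} (hx : x ∈ shiComplOne n) {i j : Fin n} (h : i ≠ j) :
    aEntry x i j ≠ 0 := by
  unfold aEntry
  rcases lt_or_gt_of_ne h with h | h
  · rw [if_pos h]; exact sub_ne_zero.2 (hx i j h).2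
  · rw [if_neg h.not_gt, if_pos h]
    intro e; exact (hx j i h).1 (by linarith)

lemma shi_col_inj {n : ℕ} {x : Fin n → ℝ} (hx : x ∈ shiComplOne n) {i i' j : Fin n}
    (h1 : i ≠ j) (h2 : i' ≠ j) (h : aEntry x i j = aEntry x i' j) : i = i' := by
  by_contra hne
  have h3 := hx i i'
  have h4 := hx i' i
  unfold aEntry at h
  rcases lt_or_gt_of_ne hne with hl | hl
  · obtain ⟨h5, h6⟩ := h3 hl
    split_ifs at h <;> first | omega | exact h5 (by linarith) | exact h6 (by linarith)
  · obtain ⟨h5, h6⟩ := h4 hl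
    split_ifs at h <;> first | omega | exact h5 (by linarith) | exact h6 (by linarith)

lemma shi_self {n : ℕ} (x : Fin n → ℝ) (i : Fin n) : aEntry x i i = 0 := by
  simp [aEntry]

lemma shi_father_unique {n : ℕ} {x : Fin n → ℝ} (hx : x ∈ shiComplOne n) {j : Fin n}
    {p q : Fin (n+1)} (hp : IsFatherOne x j p) (hq : IsFatherOne x j q) : p = q := by
  rcases hp with ⟨rfl, h1⟩ | ⟨i, rfl, h1, h2⟩ <;> rcases hq with ⟨rfl, h3⟩ | ⟨k, rfl, h3, h4⟩
  · rfl
  · exact absurd h3 (not_lt.2 (h1 k))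
  · exact absurd h1 (not_lt.2 (h3 i))
  · have hi : i ≠ j := by rintro rfl; rw [shi_self] at h1; exact lt_irrefl _ h1
    have hk : k ≠ j := by rintro rfl; rw [shi_self] at h3; exact lt_irrefl _ h3
    rw [shi_col_inj hx hi hk (le_antisymm (h2 k h3) (h4 i h1))]

lemma shi_father_exists {n : ℕ} (x : Fin n → ℝ) (j : Fin n) :
    ∃ p, IsFatherOne x j p := by
  classical
  by_cases h : ∀ i, aEntry x i j ≤ 0
  · exact ⟨0, Or.inl ⟨rfl, h⟩⟩
  push Not at h
  obtain ⟨i0, hi0⟩ := h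
  obtain ⟨i, hi, hmin⟩ := Finset.exists_min_image
    (Finset.univ.filter (fun i => 0 < aEntry x i j)) (fun i => aEntry x i j)
    ⟨i0, by simpa using hi0⟩
  simp only [Finset.mem_filter, Finset.mem_univ, true_and] at hi hmin
  exact ⟨i.succ, Or.inr ⟨i, rfl, hi, hmin⟩⟩

noncomputable def shiFath {n : ℕ} (x : Fin n → ℝ) (j : Fin n) : Fin (n+1) :=
  (shi_father_exists x j).choose

lemma shiFath_spec {n : ℕ} (x : Fin n → ℝ) (j : Fin n) : IsFatherOne x j (shiFath x j) :=
  (shi_father_exists x j).choose_spec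

lemma shi_pos_lt {n : ℕ} {x : Fin n → ℝ} {i j : Fin n} (h : 0 < aEntry x i j) : x j < x i := by
  unfold aEntry at h
  split_ifs at h <;> linarith

lemma shiFath_decr {n : ℕ} (x : Fin n → ℝ) : ShiDecr (shiFath x) := by
  classical
  refine ⟨fun j => (Finset.univ.filter (fun i => x j < x i)).card, ?_⟩
  intro v m hm
  have hlt : x v < x m := by
    rcases shiFath_spec x v with ⟨h1, _⟩ | ⟨i, h1, h2, _⟩
    · rw [hm] at h1; exact absurd h1 (Fin.succ_ne_zero m)
    · rw [hm] at h1
      rw [Fin.succ_injective _ h1]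
      exact shi_pos_lt h2
  apply Finset.card_lt_card
  rw [Finset.ssubset_iff_of_subset]
  · exact ⟨m, by simpa using hlt, by simp⟩
  · intro i hi
    simp only [Finset.mem_filter, Finset.mem_univ, true_and] at hi ⊢
    linarith

lemma shi_rec {n : ℕ} {x y : Fin n → ℝ} (hx : x ∈ shiComplOne n)
    {a l m : Fin n} (hal : a ≠ l) (hml : m ≠ l)
    (hxm : aEntry x m l ≤ aEntry x a l) (hym : 0 < aEntry y m l)
    (h1 : 0 < aEntry x a m ↔ 0 < aEntry y a m) (h2 : 0 < aEntry x m a ↔ 0 < aEntry y m a) :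
    0 < aEntry y a l := by
  by_cases ham : a = m
  · subst ham; exact hym
  have h3 := hx a m
  have h4 := hx m a
  unfold aEntry at *
  rcases lt_or_gt_of_ne ham with hA | hA <;> rcases lt_or_gt_of_ne hal with hB | hB <;>
    rcases lt_or_gt_of_ne hml with hC | hC <;>
      try (exfalso; omega)
  all_goals simp only [hA, hB, hC, hA.not_gt, hB.not_gt, hC.not_gt, if_true, if_false, forall_const]
      at * <;> first
    | order
    | (by_contra hcon
       have h5 := mt h2.2 (by linarith)
       linarith)
    | (have := h2.not.1 (by linarith)
       linarith)
    | (have := h1.1 (lt_of_le_of_ne (by linarith)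
        (fun e => by first | exact h3.1 (by linarith) | exact h3.2 (by linarith)
                           | exact h4.1 (by linarith) | exact h4.2 (by linarith)))
       linarith)

lemma shi_sign_of_fath {n : ℕ} {x y : Fin n → ℝ} (hx : x ∈ shiComplOne n)
    (hy : y ∈ shiComplOne n) (h : shiFath x = shiFath y) (a l : Fin n) :
    0 < aEntry x a l ↔ 0 < aEntry y a l := by
  obtain ⟨d, hd⟩ := shiFath_decr x
  have key : ∀ N, ∀ a l, d a + d l < N → (0 < aEntry x a l ↔ 0 < aEntry y a l) := by
    intro N
    induction N with
    | zero => intro a l hj; omega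
    | succ N ih =>
      intro a l hN
      by_cases hal : a = l
      · subst hal; simp [shi_self]
      have hfx := shiFath_spec x l
      have hfy := shiFath_spec y l
      rw [← h] at hfy
      rcases hfx with ⟨e, h1⟩ | ⟨m, e, h1, h2⟩
      · rcases hfy with ⟨e', h3⟩ | ⟨m', e', h3, h4⟩
        · exact iff_of_false (not_lt.2 (h1 a)) (not_lt.2 (h3 a))
        · rw [e] at e'; exact absurd e'.symm (Fin.succ_ne_zero _)
      · rcases hfy with ⟨e', h3⟩ | ⟨m', e', h3, h4⟩
        · rw [e] at e'; exact absurd e' (Fin.succ_ne_zero _)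
        · have hmm : m = m' := Fin.succ_injective _ (e.symm.trans e')
          subst hmm
          have hml : m ≠ l := by rintro rfl; rw [shi_self] at h1; exact lt_irrefl _ h1
          have hdm := hd l m e
          have i1 := ih a m (by omega)
          have i2 := ih m a (by omega)
          exact ⟨fun hp => shi_rec hx hal hml (h2 a hp) h3 i1 i2,
            fun hp => shi_rec hy hal hml (h4 a hp) h1 i1.symm i2.symm⟩
  exact key _ a l (Nat.lt_succ_self _)

lemma shi_fath_of_sign {n : ℕ} {x y : Fin n → ℝ} (hx : x ∈ shiComplOne n)
    (hy : y ∈ shiComplOne n) (h : ∀ a l, 0 < aEntry x a l ↔ 0 < aEntry y a l) :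
    shiFath x = shiFath y := by
  funext l
  apply shi_father_unique hy _ (shiFath_spec y l)
  rcases shiFath_spec x l with ⟨e, h1⟩ | ⟨m, e, h1, h2⟩
  · exact Or.inl ⟨e, fun i => not_lt.1 (fun hi => absurd ((h i l).2 hi) (not_lt.2 (h1 i)))⟩
  · refine Or.inr ⟨m, e, (h m l).1 h1, ?_⟩
    intro a ha
    have hxa := h2 a ((h a l).2 ha)
    have hm := (h m l).1 h1
    have hml : m ≠ l := by rintro rfl; rw [shi_self] at h1; exact lt_irrefl _ h1
    have hal : a ≠ l := by rintro rfl; rw [shi_self] at ha; exact lt_irrefl _ ha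
    by_cases ham : a = m
    · subst ham; exact le_rfl
    have i1 := h a m
    have i2 := h m a
    have h3 := hx a m
    have h4 := hx m a
    clear h h2 h1
    unfold aEntry at *
    rcases lt_or_gt_of_ne ham with hA | hA <;> rcases lt_or_gt_of_ne hal with hB | hB <;>
      rcases lt_or_gt_of_ne hml with hC | hC <;>
      try (exfalso; omega)
    all_goals simp only [hA, hB, hC, hA.not_gt, hB.not_gt, hC.not_gt, if_true, if_false, forall_const]
        at * <;> first
      | order
      | (have := i2.not.1 (by linarith)
         linarith)
      | (have := i1.1 (lt_of_le_of_ne (by linarith)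
          (fun e => by first | exact h3.1 (by linarith) | exact h3.2 (by linarith)
                             | exact h4.1 (by linarith) | exact h4.2 (by linarith)))
         linarith)

lemma shi_cont {n : ℕ} (i j : Fin n) : Continuous (fun x : Fin n → ℝ => aEntry x i j) := by
  unfold aEntry
  split_ifs <;> fun_prop

lemma shi_sign_of_comp {n : ℕ} (x y : ↥(shiComplOne n))
    (h : connectedComponent x = connectedComponent y) (a l : Fin n) :
    0 < aEntry x.1 a l ↔ 0 < aEntry y.1 a l := by
  by_cases hal : a = l
  · subst hal; simp [shi_self]
  have hc : Continuous (fun z : ↥(shiComplOne n) => aEntry z.1 a l) :=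
    (shi_cont a l).comp continuous_subtype_val
  have hcl : IsClopen {z : ↥(shiComplOne n) | 0 < aEntry z.1 a l} := by
    refine ⟨?_, isOpen_lt continuous_const hc⟩
    have : {z : ↥(shiComplOne n) | 0 < aEntry z.1 a l} = {z | 0 ≤ aEntry z.1 a l} := by
      ext z
      rw [Set.mem_ofPred_eq, Set.mem_ofPred_eq]
      exact ⟨fun h => le_of_lt h, fun h => lt_of_le_of_ne h (shi_ne z.2 hal).symm⟩
    rw [this]
    exact isClosed_le continuous_const hc
  constructor
  · intro hx
    exact hcl.connectedComponent_subset hx (h ▸ mem_connectedComponent)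
  · intro hy
    exact hcl.connectedComponent_subset hy (h ▸ mem_connectedComponent)

lemma shi_comb {n : ℕ} (y z : Fin n → ℝ) (s t : ℝ) (hst : s + t = 1) (i j : Fin n) :
    aEntry (s • y + t • z) i j = s * aEntry y i j + t * aEntry z i j := by
  have : t = 1 - s := by linarith
  subst this
  unfold aEntry
  split_ifs <;> simp <;> ring

lemma shi_comp_of_sign {n : ℕ} (x y : ↥(shiComplOne n))
    (h : ∀ a l, 0 < aEntry x.1 a l ↔ 0 < aEntry y.1 a l) :
    connectedComponent x = connectedComponent y := by
  let U : Set (Fin n → ℝ) := {z | ∀ a l, a ≠ l → 0 < aEntry x.1 a l * aEntry z a l}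
  have hU : Convex ℝ U := by
    intro y hy z hz s t hs ht hst a l hal
    rw [shi_comb y z s t hst]
    have h1 := hy a l hal
    have h2 := hz a l hal
    rcases hs.eq_or_lt with rfl | hs
    · have : t = 1 := by linarith
      subst this; simpa using h2
    · have := mul_pos hs h1
      have := mul_nonneg ht h2.le
      nlinarith
  have hUS : U ⊆ shiComplOne n := by
    intro z hz i j hij
    have h1 := hz i j hij.ne
    have h2 := hz j i hij.ne'
    have h3 := right_ne_zero_of_mul h1.ne'
    have h4 := right_ne_zero_of_mul h2.ne'
    unfold aEntry at h3 h4
    rw [if_pos hij] at h3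
    rw [if_neg hij.not_gt, if_pos hij] at h4
    exact ⟨fun e => h4 (by linarith), sub_ne_zero.1 h3⟩
  have hpre : IsPreconnected ((Subtype.val : ↥(shiComplOne n) → Fin n → ℝ) ⁻¹' U) := by
    rw [← Topology.IsInducing.subtypeVal.isPreconnected_image, Subtype.image_preimage_coe,
      Set.inter_eq_self_of_subset_right hUS]
    exact hU.isPreconnected
  have hxU : x.1 ∈ U := fun a l hal => mul_self_pos.2 (shi_ne x.2 hal)
  have hyU : y.1 ∈ U := by
    intro a l hal
    have h1 := shi_ne x.2 hal
    have h2 := shi_ne y.2 hal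
    have h3 := h a l
    rcases lt_or_gt_of_ne h1 with h1 | h1
    · exact mul_pos_of_neg_of_neg h1
        (lt_of_le_of_ne (not_lt.1 (fun h4 => absurd (h3.2 h4) h1.not_gt)) h2)
    · exact mul_pos h1 (h3.1 h1)
  exact connectedComponent_eq (hpre.subset_connectedComponent hxU hyU)

/-- The map sending a region `Δ` of the Shi arrangement `S_n` to the graph `T_x` on
`{0,1,…,n}` joining each `j ∈ {1,…,n}` to its father `p_j` (for any `x ∈ Δ`) is
well defined and is a bijection from the regions of `S_n` onto the trees on `{0,1,…,n}`. -/
theorem shi_regions_equiv_trees (n : ℕ) (hn : 0 < n) :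
    ∃ Ψ : ConnectedComponents ↥(shiComplOne n) →
        {G : SimpleGraph (Fin (n + 1)) // G.Connected ∧ G.IsAcyclic},
      Function.Bijective Ψ ∧
      ∀ x : ↥(shiComplOne n), ∀ u v : Fin (n + 1),
        (Ψ (ConnectedComponents.mk x)).val.Adj u v ↔
          ∃ (j : Fin n) (p : Fin (n + 1)), IsFatherOne x.val j p ∧
            ((u = j.succ ∧ v = p) ∨ (v = j.succ ∧ u = p)) := by
  classical
  let g : ↥(shiComplOne n) → {G : SimpleGraph (Fin (n + 1)) // G.Connected ∧ G.IsAcyclic} :=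
    fun x => ⟨shiG (shiFath x.1), (shiG_tree (shiFath_decr x.1)).connected,
      (shiG_tree (shiFath_decr x.1)).isAcyclic⟩
  have hg : ∀ x y : ↥(shiComplOne n), connectedComponent x = connectedComponent y →
      g x = g y := by
    intro x y h
    apply Subtype.ext
    change shiG (shiFath x.1) = shiG (shiFath y.1)
    rw [shi_fath_of_sign x.2 y.2 (shi_sign_of_comp x y h)]
  let Ψ : ConnectedComponents ↥(shiComplOne n) →
      {G : SimpleGraph (Fin (n + 1)) // G.Connected ∧ G.IsAcyclic} :=
    Quotient.lift g (fun x y h => hg x y h)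
  have hΨ : ∀ x, Ψ (ConnectedComponents.mk x) = g x := fun x => rfl
  refine ⟨Ψ, ⟨?_, ?_⟩, ?_⟩
  · intro A B hAB
    obtain ⟨x, rfl⟩ := ConnectedComponents.surjective_coe A
    obtain ⟨y, rfl⟩ := ConnectedComponents.surjective_coe B
    rw [hΨ, hΨ] at hAB
    have h1 : shiG (shiFath x.1) = shiG (shiFath y.1) := congrArg Subtype.val hAB
    have h2 := shiG_inj (shiFath_decr x.1) (shiFath_decr y.1) h1
    exact ConnectedComponents.coe_eq_coe.2
      (shi_comp_of_sign x y (shi_sign_of_fath x.2 y.2 h2))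
  · rintro ⟨G, hG1, hG2⟩
    obtain ⟨p, ⟨d, hd⟩, hpG⟩ := shiG_surj G ⟨hG1, hG2⟩
    obtain ⟨x, hx, hf⟩ := shi_exists p d hd
    refine ⟨ConnectedComponents.mk ⟨x, hx⟩, ?_⟩
    rw [hΨ]
    apply Subtype.ext
    change shiG (shiFath x) = G
    rw [← hpG]
    congr 1
    funext j
    exact shi_father_unique hx (shiFath_spec x j) (hf j)
  · intro x u v
    rw [hΨ]
    change (shiG (shiFath x.1)).Adj u v ↔ _
    rw [shiG_adj (shiFath_decr x.1)]
    constructor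
    · rintro ⟨j, hj⟩
      exact ⟨j, _, shiFath_spec x.1 j, hj⟩
    · rintro ⟨j, p, hp, hj⟩
      rw [shi_father_unique x.2 hp (shiFath_spec x.1 j)] at hj
      exact ⟨j, hj⟩
end

section
/- Let T be an O-rooted labeled r-tree on O ∪ V, with O = {o_1,…,o_r} and V = {v_1,…,v_n}. For every vertex v ∈ V and every valid rearrangement ν for T, the father set F_T^ν(v) is the same; i.e., the father set of each vertex is independent of the choice of valid rearrangement, and may be denoted F_T(v). -/
/-- The father set of a vertex `v ∈ V` in the graph `G` on `O ⊕ V` under the ordering `ν`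
(where `ν j` is the `j`-th vertex of the rearrangement, so `v` occupies position `ν.symm v`):
the set of neighbours of `v` that are roots or vertices occurring earlier in `ν`. -/
def fatherSet {r n : ℕ} (G : SimpleGraph (Fin r ⊕ Fin n)) (ν : Equiv.Perm (Fin n))
    (v : Fin n) : Set (Fin r ⊕ Fin n) :=
  {w | G.Adj (Sum.inr v) w ∧
    ((∃ o : Fin r, w = Sum.inl o) ∨ ∃ u : Fin n, w = Sum.inr u ∧ ν.symm u < ν.symm v)}

/-- `ν` is a valid rearrangement for `G`: each vertex of `V` is adjacent to exactly `r`
vertices among the roots and the earlier vertices, and these `r` vertices are pairwise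
adjacent in `G`. -/
def IsValidRearrangement {r n : ℕ} (G : SimpleGraph (Fin r ⊕ Fin n))
    (ν : Equiv.Perm (Fin n)) : Prop :=
  ∀ v : Fin n, Nat.card (fatherSet G ν v) = r ∧ G.IsClique (fatherSet G ν v)

/-- An `O`-rooted labeled `r`-tree on `O ⊕ V` (with `|O| = r`, `|V| = n`): a graph
admitting a valid rearrangement. -/
def IsORootedRTree {r n : ℕ} (G : SimpleGraph (Fin r ⊕ Fin n)) : Prop :=
  ∃ ν : Equiv.Perm (Fin n), IsValidRearrangement G ν

/-- The father set of each vertex of an `O`-rooted labeled `r`-tree is independent of the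
choice of valid rearrangement. -/
theorem father_set_independent_of_rearrangement (r n : ℕ) (hr : 0 < r) (hn : 0 < n)
    (G : SimpleGraph (Fin r ⊕ Fin n)) (ν₁ ν₂ : Equiv.Perm (Fin n))
    (h₁ : IsValidRearrangement G ν₁) (h₂ : IsValidRearrangement G ν₂) :
    ∀ v : Fin n, fatherSet G ν₁ v = fatherSet G ν₂ v := by
  have key : ∀ k : ℕ, ∀ v : Fin n, n - (ν₁.symm v : ℕ) = k →
      fatherSet G ν₁ v = fatherSet G ν₂ v := by
    intro k
    induction k using Nat.strong_induction_on with
    | _ k ih =>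
      intro v hk
      have hsub : fatherSet G ν₂ v ⊆ fatherSet G ν₁ v := by
        rintro w ⟨hadj, hw⟩
        refine ⟨hadj, ?_⟩
        rcases hw with ho | ⟨u, rfl, hu⟩
        · exact Or.inl ho
        · refine Or.inr ⟨u, rfl, ?_⟩
          by_contra hlt
          have hne : ν₁.symm u ≠ ν₁.symm v := by
            intro h
            have := ν₁.symm.injective h
            subst this
            exact lt_irrefl _ hu
          have hlt' : ν₁.symm v < ν₁.symm u := lt_of_le_of_ne (not_lt.mp hlt) hne.symm
          have heq := ih (n - (ν₁.symm u : ℕ)) (by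
            have h1 := (ν₁.symm u).isLt
            have h2 : (ν₁.symm v : ℕ) < (ν₁.symm u : ℕ) := hlt'
            omega) u rfl
          have hmem : (Sum.inr v : Fin r ⊕ Fin n) ∈ fatherSet G ν₁ u :=
            ⟨hadj.symm, Or.inr ⟨v, rfl, hlt'⟩⟩
          rw [heq] at hmem
          obtain ⟨-, ⟨o, ho⟩ | ⟨x, hx, hlt2⟩⟩ := hmem
          · cases ho
          · cases hx
            exact lt_asymm hu hlt2
      refine (Set.eq_of_subset_of_ncard_le hsub ?_ (Set.toFinite _)).symm
      have e1 : (fatherSet G ν₁ v).ncard = r := (h₁ v).1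
      have e2 : (fatherSet G ν₂ v).ncard = r := (h₂ v).1
      omega
  exact fun v => key _ v rfl
end

section
/- Let x ∈ ℝⁿ be generic for the r-Shi arrangement S_n^r, and let j ∈ {1,…,n} be such that the j-th column slice of the cubic matrix C_x has a positive entry, with its unique minimal positive entry at position (p_j, q_j), where p_j ≠ j. Then for all i ∈ {1,…,n} with i ≠ j and i ≠ p_j, and all k ∈ {1,…,r}: sign(c_{ijk}(x)) = sign(c_{i p_j (k−q_j+1)}(x)) if q_j ≤ k and (i, j, p_j) is even; sign(c_{ijk}(x)) = −sign(c_{p_j i (q_j−k)}(x)) if q_j > k and (i, j, p_j) is even; sign(c_{ijk}(x)) = −sign(c_{p_j i (q_j−k+1)}(x)) if q_j ≥ k and (i, j, p_j) is odd; and sign(c_{ijk}(x)) = sign(c_{i p_j (k−q_j)}(x)) if q_j < k and (i, j, p_j) is odd. Here (i, j, p_j) is called even if i < j < p_j, or p_j < i < j, or j < p_j < i, and odd otherwise. -/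
/-- The cubic matrix entry `c_{ijk}(x)`: equal to `xᵢ - xⱼ - k` if `i < j`, to `0` if
`i = j`, and to `xᵢ - xⱼ - k + 1` if `i > j` (here `k` is the actual value in `{1,…,r}`). -/
noncomputable def cEntry {n : ℕ} (x : Fin n → ℝ) (i j : Fin n) (k : ℕ) : ℝ :=
  if i < j then x i - x j - k else if j < i then x i - x j - k + 1 else 0

/-- The complement of the `r`-Shi arrangement in `ℝⁿ`, i.e. the set of points that are
generic for `S_n^r`: `c_{ijk}(x) ≠ 0` for all `i ≠ j` and `k ∈ {1,…,r}`. -/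
def shiCompl (r n : ℕ) : Set (Fin n → ℝ) :=
  {x | ∀ i j : Fin n, i ≠ j → ∀ k ∈ Finset.Icc 1 r, cEntry x i j k ≠ 0}

/-- The `j`-th column slice of the cubic matrix `C_x` has its (unique) minimal positive
entry at position `(p, q)`. -/
def IsMinPosAt (r : ℕ) {n : ℕ} (x : Fin n → ℝ) (j p : Fin n) (q : ℕ) : Prop :=
  q ∈ Finset.Icc 1 r ∧ 0 < cEntry x p j q ∧
    ∀ i : Fin n, ∀ k ∈ Finset.Icc 1 r, 0 < cEntry x i j k → cEntry x p j q ≤ cEntry x i j k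

/-- The triple `(i, j, p)` is even if `i < j < p`, or `p < i < j`, or `j < p < i`. -/
def TripleEven {n : ℕ} (i j p : Fin n) : Prop :=
  (i < j ∧ j < p) ∨ (p < i ∧ i < j) ∨ (j < p ∧ p < i)

theorem sign_aux (a c d : ℝ) (ha : 0 < a) (h : c = a + d) (hc : c ≠ 0) (hd : d ≠ 0)
    (hm : 0 < c → a ≤ c) : Real.sign c = Real.sign d := by
  rcases lt_or_gt_of_ne hc with h1 | h1
  · rw [Real.sign_of_neg h1, Real.sign_of_neg (by linarith)]
  · have h2 := hm h1
    have h3 : 0 < d := lt_of_le_of_ne (by linarith) hd.symm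
    rw [Real.sign_of_pos h1, Real.sign_of_pos h3]

/-- Sign relations among entries of the cubic matrix: if the `j`-th column slice of `C_x`
has its unique minimal positive entry at `(p, q)` with `p ≠ j`, then for `i ≠ j, p` and
`k ∈ {1,…,r}`:
`sign c_{ijk} = sign c_{ip(k-q+1)}` if `q ≤ k` and `(i,j,p)` is even;
`sign c_{ijk} = -sign c_{pi(q-k)}` if `q > k` and `(i,j,p)` is even;
`sign c_{ijk} = -sign c_{pi(q-k+1)}` if `q ≥ k` and `(i,j,p)` is odd;
`sign c_{ijk} = sign c_{ip(k-q)}` if `q < k` and `(i,j,p)` is odd. -/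
theorem cubic_matrix_sign_relations (r n : ℕ) (hr : 0 < r) (hn : 0 < n) (x : Fin n → ℝ)
    (hgen : x ∈ shiCompl r n) (j p : Fin n) (q : ℕ) (hpj : p ≠ j)
    (hmin : IsMinPosAt r x j p q)
    (i : Fin n) (hij : i ≠ j) (hip : i ≠ p) (k : ℕ) (hk : k ∈ Finset.Icc 1 r) :
    (q ≤ k → TripleEven i j p →
        Real.sign (cEntry x i j k) = Real.sign (cEntry x i p (k - q + 1))) ∧
    (k < q → TripleEven i j p →
        Real.sign (cEntry x i j k) = -Real.sign (cEntry x p i (q - k))) ∧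
    (k ≤ q → ¬TripleEven i j p →
        Real.sign (cEntry x i j k) = -Real.sign (cEntry x p i (q - k + 1))) ∧
    (q < k → ¬TripleEven i j p →
        Real.sign (cEntry x i j k) = Real.sign (cEntry x i p (k - q))) := by
  obtain ⟨hq, ha, hm⟩ := hmin
  have hc := hgen i j hij k hk
  have hmk := hm i k hk
  have hk' := Finset.mem_Icc.1 hk
  have hq' := Finset.mem_Icc.1 hq
  refine ⟨fun h ht => ?_, fun h ht => ?_, fun h ht => ?_, fun h ht => ?_⟩
  · refine sign_aux _ _ _ ha ?_ hc (hgen i p hip _ (Finset.mem_Icc.2 (by omega))) hmk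
    unfold TripleEven at ht
    unfold cEntry
    push_cast [Nat.cast_sub h]
    split_ifs <;> first | (exfalso; omega) | ring
  · rw [← Real.sign_neg]
    refine sign_aux _ _ _ ha ?_ hc
      (neg_ne_zero.2 (hgen p i hip.symm _ (Finset.mem_Icc.2 (by omega)))) hmk
    unfold TripleEven at ht
    unfold cEntry
    push_cast [Nat.cast_sub h.le]
    split_ifs <;> first | (exfalso; omega) | ring
  · rw [← Real.sign_neg]
    refine sign_aux _ _ _ ha ?_ hc
      (neg_ne_zero.2 (hgen p i hip.symm _ (Finset.mem_Icc.2 (by omega)))) hmk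
    unfold TripleEven at ht
    unfold cEntry
    push_cast [Nat.cast_sub h]
    split_ifs <;> first | (exfalso; omega) | ring
  · refine sign_aux _ _ _ ha ?_ hc (hgen i p hip _ (Finset.mem_Icc.2 (by omega))) hmk
    unfold TripleEven at ht
    unfold cEntry
    push_cast [Nat.cast_sub h.le]
    split_ifs <;> first | (exfalso; omega) | ring
end

section
/- Let x, y ∈ ℝⁿ be generic for the r-Shi arrangement S_n^r and suppose: (i) for all i, j ∈ {1,…,n−1} and k ∈ {1,…,r}, c_{ijk}(x) and c_{ijk}(y) have the same sign; (ii) for every j ∈ {1,…,n}, if the j-th column slice of C_x has a positive entry then its unique minimal positive entry does not lie in row n, and likewise for C_y; (iii) either the n-th column slices of both C_x and C_y have no positive entry, or both have their unique minimal positive entries at the same position (i′, k′) with i′ ≠ n. Then c_{ijk}(x) and c_{ijk}(y) have the same sign for all i, j ∈ {1,…,n} and k ∈ {1,…,r}; consequently x and y lie in the same region of S_n^r. -/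
theorem sign_iff_aux {a b : ℝ} (ha : a ≠ 0) (hb : b ≠ 0) :
    Real.sign a = Real.sign b ↔ (0 < a ↔ 0 < b) := by
  rcases lt_or_gt_of_ne ha with h1 | h1 <;> rcases lt_or_gt_of_ne hb with h2 | h2
  · simp [Real.sign_of_neg h1, Real.sign_of_neg h2, not_lt_of_gt h1, not_lt_of_gt h2]
  · rw [Real.sign_of_neg h1, Real.sign_of_pos h2]
    constructor
    · intro h; norm_num at h
    · intro h; linarith [h.2 h2]
  · rw [Real.sign_of_pos h1, Real.sign_of_neg h2]
    constructor
    · intro h; norm_num at h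
    · intro h; linarith [h.1 h1]
  · simp [Real.sign_of_pos h1, Real.sign_of_pos h2, h1, h2]

theorem cEntry_lt' {n : ℕ} (x : Fin n → ℝ) {i j : Fin n} (h : i < j) (k : ℕ) :
    cEntry x i j k = x i - x j - k := by simp [cEntry, h]

theorem cEntry_gt' {n : ℕ} (x : Fin n → ℝ) {i j : Fin n} (h : j < i) (k : ℕ) :
    cEntry x i j k = x i - x j - k + 1 := by simp [cEntry, h, not_lt_of_gt h]

theorem cEntry_self' {n : ℕ} (x : Fin n → ℝ) (i : Fin n) (k : ℕ) :
    cEntry x i i k = 0 := by simp [cEntry]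

/-- comparison of two coordinates with a small integer shift transfers -/
theorem transfer_aux {r n : ℕ} {x y : Fin n → ℝ} {i j : Fin n}
    (hx : x ∈ shiCompl r n)
    (h1 : ∀ k ∈ Finset.Icc 1 r, (0 < cEntry x i j k ↔ 0 < cEntry y i j k))
    (h2 : ∀ k ∈ Finset.Icc 1 r, (0 < cEntry x j i k ↔ 0 < cEntry y j i k))
    (a b : ℕ) (ha : a ∈ Finset.Icc 1 r) (hb : b ∈ Finset.Icc 1 r)
    (h : x j - b ≤ x i - a) : y j - b ≤ y i - a := by
  rw [Finset.mem_Icc] at ha hb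
  rcases lt_trichotomy i j with hij | rfl | hij
  · by_cases hab : b < a
    · have hm : a - b ∈ Finset.Icc 1 r := by rw [Finset.mem_Icc]; omega
      have hne := hx i j hij.ne _ hm
      have e := h1 _ hm
      rw [cEntry_lt' _ hij, cEntry_lt' _ hij, Nat.cast_sub hab.le] at e
      rw [cEntry_lt' _ hij, Nat.cast_sub hab.le] at hne
      have := e.1 (lt_of_le_of_ne (by linarith) hne.symm)
      linarith
    · push Not at hab
      have hm : b - a + 1 ∈ Finset.Icc 1 r := by rw [Finset.mem_Icc]; omega
      have e := h2 _ hm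
      rw [cEntry_gt' _ hij, cEntry_gt' _ hij] at e
      push_cast [Nat.cast_sub hab] at e
      by_contra hc
      push Not at hc
      have := e.2 (by linarith)
      linarith
  · linarith
  · by_cases hab : a < b
    · have hm : b - a ∈ Finset.Icc 1 r := by rw [Finset.mem_Icc]; omega
      have e := h2 _ hm
      rw [cEntry_lt' _ hij, cEntry_lt' _ hij, Nat.cast_sub hab.le] at e
      by_contra hc
      push Not at hc
      have := e.2 (by linarith)
      linarith
    · push Not at hab
      have hm : a - b + 1 ∈ Finset.Icc 1 r := by rw [Finset.mem_Icc]; omega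
      have hne := hx i j hij.ne' _ hm
      have e := h1 _ hm
      rw [cEntry_gt' _ hij, cEntry_gt' _ hij] at e
      rw [cEntry_gt' _ hij] at hne
      push_cast [Nat.cast_sub hab] at e hne
      have := e.1 (lt_of_le_of_ne (by linarith) hne.symm)
      linarith

theorem exists_minPos {r n : ℕ} (x : Fin n → ℝ) (j : Fin n)
    (h : ∃ i : Fin n, ∃ k ∈ Finset.Icc 1 r, 0 < cEntry x i j k) :
    ∃ p q, IsMinPosAt r x j p q := by
  classical
  obtain ⟨i, k, hk, hp⟩ := h
  let S := (Finset.univ ×ˢ Finset.Icc 1 r : Finset (Fin n × ℕ)).filter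
    (fun t => 0 < cEntry x t.1 j t.2)
  have hS : S.Nonempty := ⟨(i, k), by simp only [S, Finset.mem_filter, Finset.mem_product]; simp_all⟩
  obtain ⟨⟨p, q⟩, hm, hmin⟩ := Finset.exists_min_image S (fun t => cEntry x t.1 j t.2) hS
  simp only [S, Finset.mem_filter, Finset.mem_product, Finset.mem_univ, true_and] at hm hmin
  exact ⟨p, q, hm.1, hm.2, fun i k hk hp => hmin (i, k) ⟨hk, hp⟩⟩

theorem row_aux {r n : ℕ} {x y : Fin n → ℝ} (N : Fin n) (hN : ∀ i, i ≠ N → i < N)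
    (hs : ∀ i j : Fin n, i ≠ N → j ≠ N → ∀ k ∈ Finset.Icc 1 r,
      (0 < cEntry x i j k ↔ 0 < cEntry y i j k))
    (hrow : ∀ j p : Fin n, ∀ q : ℕ, IsMinPosAt r x j p q → p ≠ N)
    (hcol : ∀ i, ∀ k ∈ Finset.Icc 1 r, (0 < cEntry x i N k ↔ 0 < cEntry y i N k)) :
    ∀ j, j ≠ N → ∀ m < r, x j + m < x N → y j + m < y N := by
  classical
  by_contra hcon
  push Not at hcon
  let S := Finset.univ.filter (fun j : Fin n => j ≠ N ∧ ∃ m < r, x j + m < x N ∧ y N ≤ y j + m)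
  have hS : S.Nonempty := by
    obtain ⟨j, h1, h2⟩ := hcon
    exact ⟨j, by simp only [S, Finset.mem_filter, Finset.mem_univ, true_and]; exact ⟨h1, h2⟩⟩
  obtain ⟨j, hj, hmax⟩ := Finset.exists_max_image S x hS
  simp only [S, Finset.mem_filter, Finset.mem_univ, true_and] at hj hmax
  obtain ⟨hjN, m, hm, hxm, hym⟩ := hj
  have hmI : m + 1 ∈ Finset.Icc 1 r := by rw [Finset.mem_Icc]; omega
  have hval : cEntry x N j (m + 1) = x N - x j - m := by
    rw [cEntry_gt' _ (hN j hjN)]; push_cast; ring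
  have hpos : 0 < cEntry x N j (m + 1) := by rw [hval]; linarith
  obtain ⟨p, q, hpq⟩ := exists_minPos (r := r) x j ⟨N, m + 1, hmI, hpos⟩
  have hpN := hrow j p q hpq
  obtain ⟨hq, hp0, hpmin⟩ := hpq
  have hlt : cEntry x p j q < x N - x j - m := by
    rw [← hval]
    refine lt_of_le_of_ne (hpmin _ _ hmI hpos) fun he => ?_
    exact hrow j N (m + 1) ⟨hmI, hpos, fun i k hk h => he ▸ hpmin i k hk h⟩ rfl
  have hy0 := (hs p j hpN hjN q hq).1 hp0
  have hl : ∃ l : ℕ, l ≤ r ∧ cEntry x p j q = x p - x j - l ∧ cEntry y p j q = y p - y j - l := by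
    rw [Finset.mem_Icc] at hq
    rcases lt_trichotomy p j with h | rfl | h
    · exact ⟨q, hq.2, cEntry_lt' _ h _, cEntry_lt' _ h _⟩
    · rw [cEntry_self'] at hp0; exact absurd hp0 (lt_irrefl _)
    · refine ⟨q - 1, by omega, ?_, ?_⟩ <;>
      · rw [cEntry_gt' _ h, Nat.cast_sub hq.1]; push_cast; ring
  obtain ⟨l, hlr, hlx, hly⟩ := hl
  rw [hlx] at hp0 hlt
  rw [hly] at hy0
  by_cases hlm : l ≤ m
  · have := hmax p ⟨hpN, m - l, by omega, by push_cast [Nat.cast_sub hlm]; linarith,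
      by push_cast [Nat.cast_sub hlm]; linarith⟩
    have h0 : (0 : ℝ) ≤ l := Nat.cast_nonneg l
    linarith
  · push Not at hlm
    have e := hcol p (l - m) (by rw [Finset.mem_Icc]; omega)
    rw [cEntry_lt' _ (hN p hpN), cEntry_lt' _ (hN p hpN), Nat.cast_sub hlm.le] at e
    have := e.2 (by linarith)
    linarith

theorem col_aux {r n : ℕ} {x y : Fin n → ℝ} (N : Fin n) (hN : ∀ i, i ≠ N → i < N)
    (hx : x ∈ shiCompl r n)
    (hs : ∀ i j : Fin n, i ≠ N → j ≠ N → ∀ k ∈ Finset.Icc 1 r,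
      (0 < cEntry x i j k ↔ 0 < cEntry y i j k))
    (p : Fin n) (q : ℕ) (hp : p ≠ N) (h1 : IsMinPosAt r x N p q) (h2 : IsMinPosAt r y N p q)
    (i : Fin n) (k : ℕ) (hk : k ∈ Finset.Icc 1 r) (h : 0 < cEntry x i N k) :
    0 < cEntry y i N k := by
  have hi : i ≠ N := by
    rintro rfl
    rw [cEntry_self'] at h
    exact lt_irrefl _ h
  have h3 := h1.2.2 i k hk h
  have h4 := h2.2.1
  rw [cEntry_lt' _ (hN _ hi), cEntry_lt' _ (hN _ hp)] at h3
  rw [cEntry_lt' _ (hN _ hp)] at h4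
  rw [cEntry_lt' _ (hN _ hi)]
  have := transfer_aux hx (hs i p hi hp) (hs p i hp hi) k q hk h1.1 (by linarith)
  linarith

theorem cEntry_combo {n : ℕ} (x y : Fin n → ℝ) {i j : Fin n} (hij : i ≠ j) (k : ℕ)
    (a b : ℝ) (hab : a + b = 1) :
    cEntry (a • x + b • y) i j k = a * cEntry x i j k + b * cEntry y i j k := by
  obtain rfl : b = 1 - a := by linarith
  rcases lt_or_gt_of_ne hij with h | h
  · simp only [cEntry_lt' _ h, Pi.add_apply, Pi.smul_apply, smul_eq_mul]; ring
  · simp only [cEntry_gt' _ h, Pi.add_apply, Pi.smul_apply, smul_eq_mul]; ring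

theorem region_aux {r n : ℕ} {x y : Fin n → ℝ} (hx : x ∈ shiCompl r n) (hy : y ∈ shiCompl r n)
    (hs : ∀ i j : Fin n, ∀ k ∈ Finset.Icc 1 r, (0 < cEntry x i j k ↔ 0 < cEntry y i j k)) :
    ConnectedComponents.mk (⟨x, hx⟩ : ↥(shiCompl r n)) = ConnectedComponents.mk ⟨y, hy⟩ := by
  have hseg : segment ℝ x y ⊆ shiCompl r n := by
    rintro z ⟨a, b, ha, hb, hab, rfl⟩ i j hij k hk
    rw [cEntry_combo x y hij k a b hab]
    have e := hs i j k hk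
    rcases lt_or_gt_of_ne (hx i j hij k hk) with h1 | h1
    · have h2 : cEntry y i j k < 0 := by
        refine lt_of_le_of_ne ?_ (hy i j hij k hk)
        by_contra hc
        push Not at hc
        linarith [e.2 hc]
      apply ne_of_lt
      rcases ha.eq_or_lt with rfl | ha
      · have : b = 1 := by linarith
        subst this; linarith
      · nlinarith [mul_neg_of_pos_of_neg ha h1, mul_nonpos_of_nonneg_of_nonpos hb h2.le]
    · have h2 := e.1 h1
      apply ne_of_gt
      rcases ha.eq_or_lt with rfl | ha
      · have : b = 1 := by linarith
        subst this; linarith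
      · nlinarith [mul_pos ha h1, mul_nonneg hb h2.le]
  have hj := (JoinedIn.of_segment_subset hseg).joined_subtype
  rw [ConnectedComponents.coe_eq_coe']
  exact pathComponent_subset_component _ hj.symm

/-- Key uniqueness lemma: if two generic points `x, y` have cubic matrices whose entries
agree in sign on the first `n-1` rows and columns, whose column slices never have their
minimal positive entries in the last row, and whose last column slices either both have no
positive entry or both have their minimal positive entries at the same position `(i′,k′)`
with `i′ ≠ n`, then all cubic-matrix entries have the same sign at `x` and `y`, and hence
`x` and `y` lie in the same region of `S_n^r`. -/
theorem same_data_same_region (r n : ℕ) (hr : 0 < r) (hn : 0 < n) (x y : Fin n → ℝ)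
    (hx : x ∈ shiCompl r n) (hy : y ∈ shiCompl r n)
    (hsmall : ∀ i j : Fin n, i ≠ ⟨n - 1, by omega⟩ → j ≠ ⟨n - 1, by omega⟩ →
      ∀ k ∈ Finset.Icc 1 r, Real.sign (cEntry x i j k) = Real.sign (cEntry y i j k))
    (hrowx : ∀ j p : Fin n, ∀ q : ℕ, IsMinPosAt r x j p q → p ≠ ⟨n - 1, by omega⟩)
    (hrowy : ∀ j p : Fin n, ∀ q : ℕ, IsMinPosAt r y j p q → p ≠ ⟨n - 1, by omega⟩)
    (hlast :
      ((¬∃ i : Fin n, ∃ k ∈ Finset.Icc 1 r, 0 < cEntry x i ⟨n - 1, by omega⟩ k) ∧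
        (¬∃ i : Fin n, ∃ k ∈ Finset.Icc 1 r, 0 < cEntry y i ⟨n - 1, by omega⟩ k)) ∨
      (∃ i' : Fin n, ∃ k' : ℕ, i' ≠ ⟨n - 1, by omega⟩ ∧
        IsMinPosAt r x ⟨n - 1, by omega⟩ i' k' ∧ IsMinPosAt r y ⟨n - 1, by omega⟩ i' k')) :
    (∀ i j : Fin n, ∀ k ∈ Finset.Icc 1 r,
        Real.sign (cEntry x i j k) = Real.sign (cEntry y i j k)) ∧
      ConnectedComponents.mk (⟨x, hx⟩ : ↥(shiCompl r n)) = ConnectedComponents.mk ⟨y, hy⟩ := by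
  have hN : ∀ i : Fin n, i ≠ ⟨n - 1, by omega⟩ → i < ⟨n - 1, by omega⟩ := by
    intro i hi
    rw [Fin.lt_def]
    have h1 : (i : ℕ) ≠ n - 1 := fun h => hi (Fin.ext h)
    have h2 := i.2
    simp only
    omega
  generalize (⟨n - 1, by omega⟩ : Fin n) = N at *
  have hs : ∀ i j : Fin n, i ≠ N → j ≠ N → ∀ k ∈ Finset.Icc 1 r,
      (0 < cEntry x i j k ↔ 0 < cEntry y i j k) := by
    intro i j hi hj k hk
    by_cases hij : i = j
    · subst hij; simp [cEntry_self']
    · exact (sign_iff_aux (hx i j hij k hk) (hy i j hij k hk)).1 (hsmall i j hi hj k hk)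
  have hs' : ∀ i j : Fin n, i ≠ N → j ≠ N → ∀ k ∈ Finset.Icc 1 r,
      (0 < cEntry y i j k ↔ 0 < cEntry x i j k) := fun i j hi hj k hk => (hs i j hi hj k hk).symm
  have hcol : ∀ i, ∀ k ∈ Finset.Icc 1 r, (0 < cEntry x i N k ↔ 0 < cEntry y i N k) := by
    intro i k hk
    rcases hlast with ⟨h1, h2⟩ | ⟨p, q, hp, h1, h2⟩
    · exact ⟨fun h => absurd ⟨i, k, hk, h⟩ h1, fun h => absurd ⟨i, k, hk, h⟩ h2⟩
    · exact ⟨col_aux N hN hx hs p q hp h1 h2 i k hk, col_aux N hN hy hs' p q hp h2 h1 i k hk⟩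
  have hall : ∀ i j : Fin n, ∀ k ∈ Finset.Icc 1 r,
      (0 < cEntry x i j k ↔ 0 < cEntry y i j k) := by
    intro i j k hk
    by_cases hj : j = N
    · subst hj; exact hcol i k hk
    by_cases hi : i = N
    · subst hi
      have hk' := Finset.mem_Icc.1 hk
      have h1 := row_aux i hN hs hrowx hcol j hj (k - 1) (by omega)
      have h2 := row_aux i hN hs' hrowy (fun a b c => (hcol a b c).symm) j hj (k - 1) (by omega)
      rw [Nat.cast_sub hk'.1] at h1 h2
      push_cast at h1 h2
      rw [cEntry_gt' _ (hN j hj), cEntry_gt' _ (hN j hj)]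
      constructor
      · intro h; linarith [h1 (by linarith)]
      · intro h; linarith [h2 (by linarith)]
    · exact hs i j hi hj k hk
  refine ⟨fun i j k hk => ?_, region_aux hx hy hall⟩
  by_cases hij : i = j
  · subst hij; simp [cEntry_self']
  · exact (sign_iff_aux (hx i j hij k hk) (hy i j hij k hk)).2 (hall i j k hk)
end

section
/- Let x ∈ ℝⁿ be generic for the r-Shi arrangement S_n^r and let j ∈ {1,…,n}. Then the entries c_{ijk}(x), as (i,k) ranges over ({1,…,n} \ {j}) × {1,…,r}, are pairwise distinct. In particular, if the j-th column slice of the cubic matrix C_x has a positive entry, then it has a unique minimal positive entry. -/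
theorem shi_diff {r n : ℕ} {x : Fin n → ℝ} (hgen : x ∈ shiCompl r n) {i i' : Fin n}
    (h : i < i') (d : ℤ) (h1 : -(r : ℤ) < d) (h2 : d ≤ r) : x i - x i' ≠ d := by
  intro he
  rcases le_or_gt d 0 with hd | hd
  · obtain ⟨m, hm⟩ := Int.eq_ofNat_of_zero_le (show 0 ≤ 1 - d by omega)
    apply hgen i' i h.ne' m (Finset.mem_Icc.2 (by omega))
    have : (d : ℝ) = 1 - m := by
      have : d = 1 - m := by omega
      rw [this]; push_cast; ring
    simp only [cEntry, h, h.not_gt, if_true, if_false]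
    linarith
  · obtain ⟨m, hm⟩ := Int.eq_ofNat_of_zero_le hd.le
    apply hgen i i' h.ne m (Finset.mem_Icc.2 (by omega))
    have : (d : ℝ) = m := by rw [hm]; simp
    simp only [cEntry, h, if_true]
    linarith

theorem col_ne {r n : ℕ} {x : Fin n → ℝ} (hgen : x ∈ shiCompl r n) {i i' j : Fin n}
    (h : i < i') (hi : i ≠ j) (hi' : i' ≠ j) {k k' : ℕ} (hk : k ∈ Finset.Icc 1 r)
    (hk' : k' ∈ Finset.Icc 1 r) : cEntry x i j k ≠ cEntry x i' j k' := by
  rw [Finset.mem_Icc] at hk hk'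
  intro he
  have A := shi_diff hgen h ((k : ℤ) - k') (by omega) (by omega)
  push_cast at A
  rcases lt_or_gt_of_ne hi with a | a
  · rcases lt_or_gt_of_ne hi' with b | b
    · simp only [cEntry, a, b, if_true] at he
      exact A (by linarith)
    · have B := shi_diff hgen h ((k : ℤ) - k' + 1) (by omega) (by omega)
      push_cast at B
      simp only [cEntry, a, b, b.not_gt, if_true, if_false] at he
      exact B (by linarith)
  · have b := a.trans h
    simp only [cEntry, a, b, a.not_gt, b.not_gt, if_true, if_false] at he
    exact A (by linarith)

/-- For a generic point `x`, the entries of the `j`-th column slice of the cubic matrix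
`C_x` (over `i ≠ j` and `k ∈ {1,…,r}`) are pairwise distinct; in particular, if the slice
has a positive entry then it has a unique minimal positive entry. -/
theorem column_slice_entries_distinct (r n : ℕ) (hr : 0 < r) (hn : 0 < n) (x : Fin n → ℝ)
    (hgen : x ∈ shiCompl r n) (j : Fin n) :
    (∀ i i' : Fin n, i ≠ j → i' ≠ j → ∀ k ∈ Finset.Icc 1 r, ∀ k' ∈ Finset.Icc 1 r,
        (i, k) ≠ (i', k') → cEntry x i j k ≠ cEntry x i' j k') ∧
      ((∃ i : Fin n, ∃ k ∈ Finset.Icc 1 r, 0 < cEntry x i j k) →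
        ∃! pq : Fin n × ℕ, IsMinPosAt r x j pq.1 pq.2) := by
  have key : ∀ i i' : Fin n, i ≠ j → i' ≠ j → ∀ k ∈ Finset.Icc 1 r, ∀ k' ∈ Finset.Icc 1 r,
        (i, k) ≠ (i', k') → cEntry x i j k ≠ cEntry x i' j k' := by
    intro i i' hi hi' k hk k' hk' hne
    rcases lt_trichotomy i i' with h | h | h
    · exact col_ne hgen h hi hi' hk hk'
    · subst h
      intro he
      apply hne
      have : (k : ℝ) = k' := by
        rcases lt_or_gt_of_ne hi with a | a
        · simp only [cEntry, a, if_true] at he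
          linarith
        · simp only [cEntry, a, a.not_gt, if_true, if_false] at he
          linarith
      rw [Nat.cast_injective this]
    · exact (col_ne hgen h hi' hi hk' hk).symm
  refine ⟨key, ?_⟩
  rintro ⟨i, k, hk, hpos⟩
  have hj : ∀ (p : Fin n) (q : ℕ), 0 < cEntry x p j q → p ≠ j := by
    rintro p q h rfl
    simp [cEntry] at h
  obtain ⟨pq, hm, hmin⟩ := Finset.exists_min_image
    ((Finset.univ ×ˢ Finset.Icc 1 r).filter (fun pq : Fin n × ℕ => 0 < cEntry x pq.1 j pq.2))
    (fun pq => cEntry x pq.1 j pq.2)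
    ⟨(i, k), Finset.mem_filter.2 ⟨Finset.mem_product.2 ⟨Finset.mem_univ _, hk⟩, hpos⟩⟩
  obtain ⟨hm1, hm2⟩ := Finset.mem_filter.1 hm
  have hm3 := (Finset.mem_product.1 hm1).2
  refine ⟨pq, ⟨hm3, hm2, fun i k hk h => hmin (i, k)
    (Finset.mem_filter.2 ⟨Finset.mem_product.2 ⟨Finset.mem_univ _, hk⟩, h⟩)⟩, ?_⟩
  rintro ⟨p, q⟩ ⟨h1, h2, h3⟩
  by_contra hne
  exact key p pq.1 (hj _ _ h2) (hj _ _ hm2) q h1 pq.2 hm3 hne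
    (le_antisymm (h3 _ _ hm3 hm2) (hmin (p, q)
      (Finset.mem_filter.2 ⟨Finset.mem_product.2 ⟨Finset.mem_univ _, h1⟩, h2⟩)))
end

section
/- Let x ∈ ℝⁿ be generic for the r-Shi arrangement S_n^r. Define π : {1,…,n} → {0,1,…,n} by setting π(j) = p_j, the row index of the unique minimal positive entry of the j-th column slice of the cubic matrix C_x, if that slice has a positive entry, and π(j) = 0 otherwise; extend by π(0) = 0. Then whenever π(j) ≠ 0 one has π(j) ≠ j and x_{π(j)} > x_j, and for every j ∈ {1,…,n} there exists m ∈ {1,…,n} with π^m(j) = 0 (π^m denoting the m-fold iterate of π). -/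
/-- For a generic point `x`, let `π : [n] → {0,1,…,n}` send `j` to the row index of the
unique minimal positive entry of the `j`-th column slice of `C_x` (and to `0`, encoded as
`none`, if that slice has no positive entry). Then `π(j) ≠ 0` implies `π(j) ≠ j` and
`x_{π(j)} > x_j`, and every `j` reaches `0` after at most `n` iterations of `π`. -/
theorem father_map_iterates_to_root (r n : ℕ) (hr : 0 < r) (hn : 0 < n) (x : Fin n → ℝ)
    (hgen : x ∈ shiCompl r n) (π : Fin n → Option (Fin n))
    (hπ : ∀ j p : Fin n, π j = some p ↔ ∃ q : ℕ, IsMinPosAt r x j p q) :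
    (∀ j p : Fin n, π j = some p → p ≠ j ∧ x j < x p) ∧
      ∀ j : Fin n, ∃ m : ℕ, 1 ≤ m ∧ m ≤ n ∧
        (fun o : Option (Fin n) => o.bind π)^[m] (some j) = none := by
  have h1 : ∀ j p : Fin n, π j = some p → p ≠ j ∧ x j < x p := by
    intro j p h
    obtain ⟨q, hq, hpos, -⟩ := (hπ j p).1 h
    have hq1 : (1 : ℝ) ≤ q := by exact_mod_cast (Finset.mem_Icc.1 hq).1
    have hlt : x j < x p := by
      unfold cEntry at hpos
      split_ifs at hpos
      · linarith
      · linarith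
      · exact absurd hpos (lt_irrefl _)
    refine ⟨?_, hlt⟩
    rintro rfl
    exact lt_irrefl _ hlt
  refine ⟨h1, ?_⟩
  have key : ∀ N : ℕ, ∀ j : Fin n, (Finset.univ.filter (fun i => x j < x i)).card ≤ N →
      ∃ m : ℕ, 1 ≤ m ∧ m ≤ N + 1 ∧
        (fun o : Option (Fin n) => o.bind π)^[m] (some j) = none := by
    intro N
    induction N with
    | zero =>
      intro j hj
      refine ⟨1, le_rfl, le_rfl, ?_⟩
      cases hp : π j with
      | none => simp [hp]
      | some p =>
        have : p ∈ Finset.univ.filter (fun i => x j < x i) := by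
          simpa using (h1 j p hp).2
        have := Finset.card_pos.2 ⟨p, this⟩
        omega
    | succ N ih =>
      intro j hj
      cases hp : π j with
      | none => exact ⟨1, le_rfl, by omega, by simp [hp]⟩
      | some p =>
        have hlt := (h1 j p hp).2
        have hss : Finset.univ.filter (fun i => x p < x i) ⊂
            Finset.univ.filter (fun i => x j < x i) := by
          rw [Finset.ssubset_iff_of_subset]
          · exact ⟨p, by simpa using hlt, by simp⟩
          · intro i hi
            simp only [Finset.mem_filter, Finset.mem_univ, true_and] at hi ⊢
            exact hlt.trans hi
        have := Finset.card_lt_card hss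
        obtain ⟨m, hm1, hm2, hm⟩ := ih p (by omega)
        refine ⟨m + 1, by omega, by omega, ?_⟩
        rw [Function.iterate_succ_apply]
        simpa [hp] using hm
  intro j
  have hc : (Finset.univ.filter (fun i => x j < x i)).card < n := by
    have h := Finset.card_lt_card (Finset.filter_ssubset.2 ⟨j, Finset.mem_univ j, lt_irrefl (x j)⟩ :
      Finset.univ.filter (fun i => x j < x i) ⊂ Finset.univ)
    simpa using h
  obtain ⟨m, hm1, hm2, hm⟩ := key (n - 1) j (by omega)
  exact ⟨m, hm1, by omega, hm⟩
end

section
/- Let x, y ∈ ℝⁿ be generic for the r-Shi arrangement S_n^r and suppose they lie in the same region, i.e., c_{ijk}(x) and c_{ijk}(y) have the same sign for all i, j ∈ {1,…,n} and k ∈ {1,…,r}. Then for every j ∈ {1,…,n}: the j-th column slice of C_x has a positive entry if and only if the j-th column slice of C_y does, and in that case their unique minimal positive entries occur at the same position (p_j, q_j). In other words, the data (p_j, q_j) depend only on the region containing x. -/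
theorem pos_of_sign_eq' {a b : ℝ} (h : Real.sign a = Real.sign b) (ha : 0 < a) : 0 < b := by
  rw [Real.sign_of_pos ha] at h
  rcases lt_trichotomy b 0 with hb | hb | hb
  · rw [Real.sign_of_neg hb] at h; norm_num at h
  · rw [hb, Real.sign_zero] at h; norm_num at h
  · exact hb

theorem neg_of_sign_eq' {a b : ℝ} (h : Real.sign a = Real.sign b) (ha : a < 0) : b < 0 := by
  rw [Real.sign_of_neg ha] at h
  rcases lt_trichotomy b 0 with hb | hb | hb
  · exact hb
  · rw [hb, Real.sign_zero] at h; norm_num at h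
  · rw [Real.sign_of_pos hb] at h; norm_num at h

/-- The sign of `x p - x i - s` is determined by the region, for `s` in the right range. -/
theorem diff_le {r n : ℕ} {x y : Fin n → ℝ}
    (hsame : ∀ i j : Fin n, ∀ k ∈ Finset.Icc 1 r,
      Real.sign (cEntry x i j k) = Real.sign (cEntry y i j k))
    (p i : Fin n) (hpi : p ≠ i) (s : ℤ) (h1 : -(r : ℤ) ≤ s) (h2 : s ≤ r)
    (h3 : p < i → s ≠ -(r : ℤ)) (h4 : i < p → s ≠ r)
    (hle : x p - x i ≤ s) : y p - y i ≤ s := by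
  by_contra hc
  push Not at hc
  rcases lt_or_gt_of_ne hpi with hlt | hlt
  · have h3 := h3 hlt
    rcases le_or_gt s 0 with hs | hs
    · obtain ⟨m, hm⟩ := Int.eq_ofNat_of_zero_le (show 0 ≤ 1 - s by omega)
      have e := hsame i p m (by simp; omega)
      have hm' : (s : ℝ) = 1 - m := by
        have : s = 1 - (m : ℤ) := by omega
        rw [this]; push_cast; ring
      simp only [cEntry, hlt, not_lt_of_gt hlt, if_true, if_false] at e
      have := neg_of_sign_eq' e.symm (by linarith)
      linarith
    · obtain ⟨m, hm⟩ := Int.eq_ofNat_of_zero_le (show 0 ≤ s by omega)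
      have e := hsame p i m (by simp; omega)
      have hm' : (s : ℝ) = m := by rw [hm]; simp
      simp only [cEntry, hlt, if_true] at e
      have := pos_of_sign_eq' e.symm (by linarith)
      linarith
  · have h4 := h4 hlt
    rcases lt_or_ge s 0 with hs | hs
    · obtain ⟨m, hm⟩ := Int.eq_ofNat_of_zero_le (show 0 ≤ - s by omega)
      have e := hsame i p m (by simp; omega)
      have hm' : (s : ℝ) = - m := by
        have : s = - (m : ℤ) := by omega
        rw [this]; push_cast; ring
      simp only [cEntry, hlt, if_true] at e
      have := neg_of_sign_eq' e.symm (by linarith)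
      linarith
    · obtain ⟨m, hm⟩ := Int.eq_ofNat_of_zero_le hs
      have e := hsame p i (m + 1) (by simp; omega)
      have hm' : (s : ℝ) = m := by rw [hm]; simp
      simp only [cEntry, hlt, not_lt_of_gt hlt, if_true, if_false] at e
      push_cast at e
      have := pos_of_sign_eq' e.symm (by linarith)
      linarith

theorem cEntry_eq {n : ℕ} (p j : Fin n) (h : p ≠ j) :
    ∃ e : ℤ, ((p < j ∧ e = 0) ∨ (j < p ∧ e = 1)) ∧
      ∀ (x : Fin n → ℝ) (q : ℕ), cEntry x p j q = x p - x j - q + e := by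
  rcases lt_or_gt_of_ne h with hlt | hlt
  · exact ⟨0, Or.inl ⟨hlt, rfl⟩, fun x q => by simp [cEntry, hlt]⟩
  · exact ⟨1, Or.inr ⟨hlt, rfl⟩, fun x q => by simp [cEntry, hlt, not_lt_of_gt hlt]⟩

theorem ne_of_cEntry_pos {n : ℕ} {x : Fin n → ℝ} {p j : Fin n} {q : ℕ}
    (h : 0 < cEntry x p j q) : p ≠ j := by
  rintro rfl
  simp [cEntry] at h

theorem isMinPosAt_of {r n : ℕ} {x y : Fin n → ℝ}
    (hsame : ∀ i j : Fin n, ∀ k ∈ Finset.Icc 1 r,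
      Real.sign (cEntry x i j k) = Real.sign (cEntry y i j k))
    {j p : Fin n} {q : ℕ} (h : IsMinPosAt r x j p q) : IsMinPosAt r y j p q := by
  obtain ⟨hq, hpos, hmin⟩ := h
  refine ⟨hq, pos_of_sign_eq' (hsame _ _ _ hq) hpos, fun i k hk hik => ?_⟩
  have hle := hmin i k hk (pos_of_sign_eq' (hsame _ _ _ hk).symm hik)
  obtain ⟨e, he, hp⟩ := cEntry_eq p j (ne_of_cEntry_pos hpos)
  obtain ⟨f, hf, hi⟩ := cEntry_eq i j (ne_of_cEntry_pos hik)
  rw [hp, hi] at hle ⊢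
  rw [Finset.mem_Icc] at hq hk
  by_cases hpi : p = i
  · subst hpi
    linarith
  · have := diff_le hsame p i hpi ((q : ℤ) - k - e + f) (by omega) (by omega)
      (by intro h; omega) (by intro h; omega) (by push_cast; linarith)
    push_cast at this
    linarith

/-- If two generic points `x, y` lie in the same region of `S_n^r` (all cubic-matrix
entries have the same sign), then for every `j` the `j`-th column slices of `C_x` and `C_y`
simultaneously have or lack positive entries, and when they have them, their unique minimal
positive entries occur at the same position `(p_j, q_j)`. -/
theorem min_pos_entry_depends_only_on_region (r n : ℕ) (hr : 0 < r) (hn : 0 < n)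
    (x y : Fin n → ℝ) (hx : x ∈ shiCompl r n) (hy : y ∈ shiCompl r n)
    (hsame : ∀ i j : Fin n, ∀ k ∈ Finset.Icc 1 r,
      Real.sign (cEntry x i j k) = Real.sign (cEntry y i j k)) :
    ∀ j : Fin n,
      ((∃ i : Fin n, ∃ k ∈ Finset.Icc 1 r, 0 < cEntry x i j k) ↔
        (∃ i : Fin n, ∃ k ∈ Finset.Icc 1 r, 0 < cEntry y i j k)) ∧
      ∀ p : Fin n, ∀ q : ℕ, IsMinPosAt r x j p q ↔ IsMinPosAt r y j p q := by
  intro j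
  refine ⟨⟨?_, ?_⟩, fun p q => ⟨isMinPosAt_of hsame,
    isMinPosAt_of fun i j k hk => (hsame i j k hk).symm⟩⟩
  · rintro ⟨i, k, hk, h⟩
    exact ⟨i, k, hk, pos_of_sign_eq' (hsame _ _ _ hk) h⟩
  · rintro ⟨i, k, hk, h⟩
    exact ⟨i, k, hk, pos_of_sign_eq' (hsame _ _ _ hk).symm h⟩
end
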